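/- Suppose $\mu > 0$ and $v$ is $\mu$-panharmonic (i.e. $\nabla^2 v = \mu^2 v$) on a domain $\Omega \subset \mathbb{R}^2$, with $v \geq 0$ on $\Omega$ and $v$ not identically zero. Then for every closed disc $\overline{D_r(x)} \subset \Omega$, the strict inequality $\frac{1}{2}\, v(x) < \frac{1}{\pi r^2}\int_{D_r(x)} v(y)\, \log\frac{r}{|x-y|}\, dy$ holds. -/

import Mathlib

open MeasureTheory Real intervalIntegral

/-- Modified Bessel function of the first kind, order 0. -/
noncomputable def besselI0 (t : ℝ) : ℝ :=
  (1 / π) * ∫ θ in (0:ℝ)..π, Real.cosh (t * Real.cos θ)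

/-- Modified Bessel function of the first kind, order 1. -/
noncomputable def besselI1 (t : ℝ) : ℝ :=
  (1 / π) * ∫ θ in (0:ℝ)..π, Real.cosh (t * Real.cos θ) * Real.cos θ

/-- Bessel function of the first kind, order 0. -/
noncomputable def besselJ0 (t : ℝ) : ℝ :=
  (1 / π) * ∫ θ in (0:ℝ)..π, Real.cos (t * Real.sin θ)

/-- The Euclidean plane. -/
abbrev E2 := EuclideanSpace ℝ (Fin 2)

/-- The Laplacian of a function on the plane, as a sum of second partial derivatives. -/
noncomputable def lap (f : E2 → ℝ) (y : E2) : ℝ :=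
  ∑ i : Fin 2,
    fderiv ℝ (fun z => fderiv ℝ f z (EuclideanSpace.single i 1)) y (EuclideanSpace.single i 1)

/-- The point on the circle of radius `r` about `x` at angle `θ`. -/
noncomputable def circlePt (x : E2) (r θ : ℝ) : E2 :=
  x + (r * Real.cos θ) • EuclideanSpace.single 0 1 + (r * Real.sin θ) • EuclideanSpace.single 1 1


open Set Filter Topology

/-- Unit radial direction. -/
noncomputable def ed (θ : ℝ) : E2 :=
  Real.cos θ • EuclideanSpace.single 0 1 + Real.sin θ • EuclideanSpace.single 1 1

/-- Unit tangential direction. -/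
noncomputable def en (θ : ℝ) : E2 :=
  (-Real.sin θ) • EuclideanSpace.single 0 1 + Real.cos θ • EuclideanSpace.single 1 1

lemma ed_cont : Continuous ed := by unfold ed; fun_prop
lemma en_cont : Continuous en := by unfold en; fun_prop

lemma ed_deriv (θ : ℝ) : HasDerivAt ed (en θ) θ := by
  unfold ed en
  exact ((Real.hasDerivAt_cos θ).smul_const _).add ((Real.hasDerivAt_sin θ).smul_const _)

lemma en_deriv (θ : ℝ) : HasDerivAt en (-ed θ) θ := by
  unfold ed en
  refine HasDerivAt.congr_deriv
    (((Real.hasDerivAt_sin θ).neg.smul_const (EuclideanSpace.single 0 1 : E2)).add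
    ((Real.hasDerivAt_cos θ).smul_const (EuclideanSpace.single 1 1 : E2))) ?_
  simp only [neg_add, neg_smul]

lemma norm_ed (θ : ℝ) : ‖ed θ‖ = 1 := by
  rw [EuclideanSpace.norm_eq]
  simp [ed, Fin.sum_univ_two]

lemma exists_polar (z : E2) : ∃ θ ∈ Icc (-π) π, z = ‖z‖ • ed θ := by
  refine ⟨Complex.arg ⟨z 0, z 1⟩, ⟨(Complex.neg_pi_lt_arg _).le, Complex.arg_le_pi _⟩, ?_⟩
  have hn : ‖z‖ = ‖(⟨z 0, z 1⟩ : ℂ)‖ := by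
    rw [EuclideanSpace.norm_eq, Complex.norm_def, Complex.normSq_apply]
    simp [Fin.sum_univ_two, sq]
  rw [hn]
  ext i
  fin_cases i
  · simp [ed]
  · simp [ed]

/-- Differentiation under an interval integral with jointly continuous derivative. -/
lemma hasDerivAt_param (F F' : ℝ → ℝ → ℝ) (hF : ∀ ρ, Continuous (F ρ))
    (hF' : Continuous (fun p : ℝ × ℝ => F' p.1 p.2))
    (hd : ∀ ρ θ, HasDerivAt (fun s => F s θ) (F' ρ θ) ρ) (a b ρ : ℝ) :
    HasDerivAt (fun s => ∫ θ in a..b, F s θ) (∫ θ in a..b, F' ρ θ) ρ := by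
  obtain ⟨C, hC⟩ := ((isCompact_Icc (a := ρ - 1) (b := ρ + 1)).prod
    (isCompact_uIcc (a := a) (b := b))).exists_bound_of_continuousOn hF'.continuousOn
  refine (intervalIntegral.hasDerivAt_integral_of_dominated_loc_of_deriv_le
    (s := Icc (ρ - 1) (ρ + 1)) (bound := fun _ => C) (F := F) (F' := F')
    (Icc_mem_nhds (by linarith) (by linarith)) ?_ ?_ ?_ ?_ ?_ ?_).2
  · exact Eventually.of_forall fun s => (hF s).aestronglyMeasurable
  · exact (hF ρ).intervalIntegrable _ _
  · exact (hF'.comp (Continuous.prodMk_right ρ)).aestronglyMeasurable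
  · exact Eventually.of_forall fun t ht s hs => hC (s, t) ⟨hs, uIoc_subset_uIcc ht⟩
  · exact intervalIntegrable_const
  · exact Eventually.of_forall fun t ht s hs => hd s t

/-- Circular integral. -/
noncomputable def cM (w : E2 → ℝ) (x : E2) (ρ : ℝ) : ℝ := ∫ θ in (-π)..π, w (x + ρ • ed θ)

/-- Circular integral of the radial derivative. -/
noncomputable def cN (w : E2 → ℝ) (x : E2) (ρ : ℝ) : ℝ :=
  ∫ θ in (-π)..π, fderiv ℝ w (x + ρ • ed θ) (ed θ)

section
variable {w : E2 → ℝ} (hw : ContDiff ℝ 2 w) (x : E2)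

lemma D_cd (hw : ContDiff ℝ 2 w) : ContDiff ℝ 1 (fderiv ℝ w) :=
  hw.fderiv_right (by norm_num)

lemma D_cont (hw : ContDiff ℝ 2 w) : Continuous (fderiv ℝ w) := (D_cd hw).continuous

lemma H_cont (hw : ContDiff ℝ 2 w) : Continuous (fderiv ℝ (fderiv ℝ w)) :=
  (D_cd hw).continuous_fderiv (by norm_num)

lemma w_d (hw : ContDiff ℝ 2 w) (y : E2) : HasFDerivAt w (fderiv ℝ w y) y :=
  (hw.differentiable (by norm_num) y).hasFDerivAt

lemma D_d (hw : ContDiff ℝ 2 w) (y : E2) :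
    HasFDerivAt (fderiv ℝ w) (fderiv ℝ (fderiv ℝ w) y) y :=
  ((D_cd hw).differentiable (by norm_num) y).hasFDerivAt

lemma ray_d (x : E2) (ρ θ : ℝ) : HasDerivAt (fun s : ℝ => x + s • ed θ) (ed θ) ρ := by
  simpa using ((hasDerivAt_id ρ).smul_const (ed θ)).const_add x

lemma arc_d (x : E2) (ρ θ : ℝ) : HasDerivAt (fun t : ℝ => x + ρ • ed t) (ρ • en θ) θ :=
  ((ed_deriv θ).const_smul ρ).const_add x

lemma cM_deriv (hw : ContDiff ℝ 2 w) (x : E2) (ρ : ℝ) :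
    HasDerivAt (cM w x) (cN w x ρ) ρ := by
  have := ed_cont
  have := hw.continuous
  have := D_cont hw
  exact hasDerivAt_param (fun s θ => w (x + s • ed θ))
    (fun s θ => fderiv ℝ w (x + s • ed θ) (ed θ)) (by intro ρ; fun_prop) (by fun_prop)
    (fun s θ => (w_d hw _).comp_hasDerivAt s (ray_d x s θ)) _ _ _

lemma cN_deriv (hw : ContDiff ℝ 2 w) (x : E2) (ρ : ℝ) :
    HasDerivAt (cN w x)
      (∫ θ in (-π)..π, fderiv ℝ (fderiv ℝ w) (x + ρ • ed θ) (ed θ) (ed θ)) ρ := by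
  have := ed_cont
  have := D_cont hw
  have := H_cont hw
  refine hasDerivAt_param (fun s θ => fderiv ℝ w (x + s • ed θ) (ed θ))
    (fun s θ => fderiv ℝ (fderiv ℝ w) (x + s • ed θ) (ed θ) (ed θ))
    (by intro ρ; fun_prop) (by fun_prop) (fun s θ => ?_) _ _ _
  have h1 := (D_d hw _).comp_hasDerivAt s (ray_d x s θ)
  simpa using h1.clm_apply (hasDerivAt_const s (ed θ))

lemma ang (hw : ContDiff ℝ 2 w) (x : E2) (ρ : ℝ) :
    ρ * (∫ θ in (-π)..π, fderiv ℝ (fderiv ℝ w) (x + ρ • ed θ) (en θ) (en θ)) = cN w x ρ := by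
  have c1 := ed_cont
  have c2 := D_cont hw
  have c3 := H_cont hw
  have c4 := en_cont
  have hd : ∀ θ ∈ uIcc (-π) π, HasDerivAt (fun t => fderiv ℝ w (x + ρ • ed t) (en t))
      (ρ * fderiv ℝ (fderiv ℝ w) (x + ρ • ed θ) (en θ) (en θ)
        - fderiv ℝ w (x + ρ • ed θ) (ed θ)) θ := by
    intro θ _
    have h1 := (D_d hw _).comp_hasDerivAt θ (arc_d x ρ θ)
    have h2 := h1.clm_apply (en_deriv θ)
    refine HasDerivAt.congr_deriv h2 ?_
    simp [sub_eq_add_neg]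
  have h := intervalIntegral.integral_eq_sub_of_hasDerivAt hd
    (Continuous.intervalIntegrable (by fun_prop) _ _)
  rw [intervalIntegral.integral_sub (Continuous.intervalIntegrable (by fun_prop) _ _)
    (Continuous.intervalIntegrable (by fun_prop) _ _), intervalIntegral.integral_const_mul] at h
  have e1 : ed π = ed (-π) := by simp [ed]
  have e2 : en π = en (-π) := by simp [en]
  rw [e1, e2, sub_self] at h
  unfold cN
  linarith

lemma lap_eq (hw : ContDiff ℝ 2 w) (y : E2) (θ : ℝ) :
    fderiv ℝ (fderiv ℝ w) y (ed θ) (ed θ) + fderiv ℝ (fderiv ℝ w) y (en θ) (en θ) = lap w y := by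
  have key : ∀ i : Fin 2, fderiv ℝ (fun z => fderiv ℝ w z (EuclideanSpace.single i 1)) y
      (EuclideanSpace.single i 1) = fderiv ℝ (fderiv ℝ w) y (EuclideanSpace.single i 1)
      (EuclideanSpace.single i 1) := by
    intro i
    have := ((D_d hw y).clm_apply (hasFDerivAt_const (EuclideanSpace.single i 1 : E2) y)).fderiv
    rw [this]; simp
  unfold lap
  rw [Fin.sum_univ_two, key, key]
  simp only [ed, en, map_add, map_smul, add_apply,
    smul_apply, smul_eq_mul]
  linear_combination (fderiv ℝ (fderiv ℝ w) y (EuclideanSpace.single 0 1)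
      (EuclideanSpace.single 0 1) + fderiv ℝ (fderiv ℝ w) y (EuclideanSpace.single 1 1)
      (EuclideanSpace.single 1 1)) * Real.sin_sq_add_cos_sq θ

lemma P_deriv (hw : ContDiff ℝ 2 w) (x : E2) (r μ : ℝ)
    (hpan : ∀ y ∈ Metric.closedBall x r, lap w y = μ ^ 2 * w y) (ρ : ℝ) (hρ : ρ ∈ Icc 0 r) :
    HasDerivAt (fun s => s * cN w x s) (μ ^ 2 * ρ * cM w x ρ) ρ := by
  have c1 := ed_cont
  have c3 := H_cont hw
  have c4 := en_cont
  refine HasDerivAt.congr_deriv ((hasDerivAt_id ρ).mul (cN_deriv hw x ρ)) ?_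
  simp only [id, one_mul]
  rw [← ang hw x ρ, ← mul_add, ← intervalIntegral.integral_add
    (Continuous.intervalIntegrable (by fun_prop) _ _)
    (Continuous.intervalIntegrable (by fun_prop) _ _)]
  have : ∀ θ, fderiv ℝ (fderiv ℝ w) (x + ρ • ed θ) (en θ) (en θ) +
      fderiv ℝ (fderiv ℝ w) (x + ρ • ed θ) (ed θ) (ed θ) = μ ^ 2 * w (x + ρ • ed θ) := by
    intro θ
    rw [add_comm, lap_eq hw, hpan]
    simp [norm_smul, norm_ed, abs_of_nonneg hρ.1, hρ.2]
  simp_rw [this]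
  rw [intervalIntegral.integral_const_mul]
  unfold cM
  ring

lemma cM_zero (w : E2 → ℝ) (x : E2) : cM w x 0 = 2 * π * w x := by
  simp only [cM, zero_smul, add_zero, intervalIntegral.integral_const, smul_eq_mul]; ring

lemma mem_cb (x : E2) {r ρ : ℝ} (hρ : ρ ∈ Icc 0 r) (θ : ℝ) :
    x + ρ • ed θ ∈ Metric.closedBall x r := by
  simp [norm_smul, norm_ed, abs_of_nonneg hρ.1, hρ.2]

lemma cM_nonneg (x : E2) (r : ℝ) (hnn : ∀ y ∈ Metric.closedBall x r, 0 ≤ w y)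
    (ρ : ℝ) (hρ : ρ ∈ Icc 0 r) : 0 ≤ cM w x ρ := by
  refine intervalIntegral.integral_nonneg (by linarith [Real.pi_pos]) fun θ _ => hnn _ (mem_cb x hρ θ)

lemma mono_of {f f' : ℝ → ℝ} {r : ℝ} (h : ∀ ρ ∈ Icc 0 r, HasDerivAt f (f' ρ) ρ)
    (h' : ∀ ρ ∈ Ioo 0 r, 0 ≤ f' ρ) : MonotoneOn f (Icc 0 r) := by
  refine monotoneOn_of_hasDerivWithinAt_nonneg (convex_Icc 0 r) (f' := f')
    (fun ρ hρ => (h ρ hρ).continuousAt.continuousWithinAt) ?_ ?_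
  · intro ρ hρ
    rw [interior_Icc] at hρ
    exact (h ρ (Ioo_subset_Icc_self hρ)).hasDerivWithinAt
  · intro ρ hρ
    rw [interior_Icc] at hρ
    exact h' ρ hρ

lemma cN_nonneg (hw : ContDiff ℝ 2 w) (x : E2) (r μ : ℝ)
    (hpan : ∀ y ∈ Metric.closedBall x r, lap w y = μ ^ 2 * w y)
    (hnn : ∀ y ∈ Metric.closedBall x r, 0 ≤ w y) (ρ : ℝ) (hρ : ρ ∈ Ioo 0 r) :
    0 ≤ cN w x ρ := by
  have := mono_of (P_deriv hw x r μ hpan) fun s hs => by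
    have := cM_nonneg x r hnn s (Ioo_subset_Icc_self hs)
    have := hs.1
    positivity
  have := this ⟨le_rfl, hρ.1.le.trans hρ.2.le⟩ (Ioo_subset_Icc_self hρ) hρ.1.le
  simp only [zero_mul] at this
  exact nonneg_of_mul_nonneg_right this hρ.1

lemma cM_mono (hw : ContDiff ℝ 2 w) (x : E2) (r μ : ℝ)
    (hpan : ∀ y ∈ Metric.closedBall x r, lap w y = μ ^ 2 * w y)
    (hnn : ∀ y ∈ Metric.closedBall x r, 0 ≤ w y) : MonotoneOn (cM w x) (Icc 0 r) :=
  mono_of (fun ρ _ => cM_deriv hw x ρ) (cN_nonneg hw x r μ hpan hnn)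

lemma cN_pos (hw : ContDiff ℝ 2 w) (x : E2) (r μ : ℝ) (hμ : 0 < μ)
    (hpan : ∀ y ∈ Metric.closedBall x r, lap w y = μ ^ 2 * w y)
    (hnn : ∀ y ∈ Metric.closedBall x r, 0 ≤ w y) (hx : 0 < w x) (ρ : ℝ) (hρ : ρ ∈ Ioo 0 r) :
    0 < cN w x ρ := by
  have : StrictMonoOn (fun s => s * cN w x s) (Icc 0 r) := by
    refine strictMonoOn_of_hasDerivWithinAt_pos (convex_Icc 0 r)
      (f' := fun ρ => μ ^ 2 * ρ * cM w x ρ)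
      (fun ρ hρ => (P_deriv hw x r μ hpan ρ hρ).continuousAt.continuousWithinAt) ?_ ?_
    · intro ρ hρ
      rw [interior_Icc] at hρ
      exact (P_deriv hw x r μ hpan ρ (Ioo_subset_Icc_self hρ)).hasDerivWithinAt
    · intro ρ hρ
      rw [interior_Icc] at hρ
      have h := cM_mono hw x r μ hpan hnn ⟨le_rfl, hρ.1.le.trans hρ.2.le⟩
        (Ioo_subset_Icc_self hρ) hρ.1.le
      rw [cM_zero] at h
      have : 0 < cM w x ρ := lt_of_lt_of_le (by positivity) h
      have := hρ.1
      positivity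
  have := this ⟨le_rfl, hρ.1.le.trans hρ.2.le⟩ (Ioo_subset_Icc_self hρ) hρ.1
  simp only [zero_mul] at this
  exact pos_of_mul_pos_right this hρ.1.le

lemma cM_strict (hw : ContDiff ℝ 2 w) (x : E2) (r μ : ℝ) (hμ : 0 < μ)
    (hpan : ∀ y ∈ Metric.closedBall x r, lap w y = μ ^ 2 * w y)
    (hnn : ∀ y ∈ Metric.closedBall x r, 0 ≤ w y) (hx : 0 < w x) :
    StrictMonoOn (cM w x) (Icc 0 r) := by
  refine strictMonoOn_of_hasDerivWithinAt_pos (convex_Icc 0 r) (f' := cN w x)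
    (fun ρ hρ => (cM_deriv hw x ρ).continuousAt.continuousWithinAt) ?_ ?_
  · intro ρ hρ
    exact (cM_deriv hw x ρ).hasDerivWithinAt
  · intro ρ hρ
    rw [interior_Icc] at hρ
    exact cN_pos hw x r μ hμ hpan hnn hx ρ hρ

lemma cM_le (hw : ContDiff ℝ 2 w) (x : E2) (r μ : ℝ)
    (hpan : ∀ y ∈ Metric.closedBall x r, lap w y = μ ^ 2 * w y)
    (hnn : ∀ y ∈ Metric.closedBall x r, 0 ≤ w y) (hx : w x = 0) (ρ : ℝ) (hρ : ρ ∈ Icc 0 r) :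
    cM w x ρ = 0 := by
  have h0 : (0 : ℝ) ∈ Icc 0 r := ⟨le_rfl, hρ.1.trans hρ.2⟩
  have hT : MonotoneOn (fun s => μ ^ 2 * s ^ 2 / 2 * cM w x s - s * cN w x s) (Icc 0 r) := by
    refine mono_of (f' := fun s => μ ^ 2 * s ^ 2 / 2 * cN w x s) ?_ ?_
    · intro s hs
      have h1 : HasDerivAt (fun s : ℝ => μ ^ 2 * s ^ 2 / 2) (μ ^ 2 * s) s := by
        have := (((hasDerivAt_id s).pow 2).const_mul (μ ^ 2)).div_const 2
        refine HasDerivAt.congr_deriv this ?_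
        simp; ring
      refine HasDerivAt.congr_deriv
        ((h1.mul (cM_deriv hw x s)).sub (P_deriv hw x r μ hpan s hs)) ?_
      ring
    · intro s hs
      have := cN_nonneg hw x r μ hpan hnn s hs
      positivity
  have hE : MonotoneOn (fun s => -(cM w x s * Real.exp (-(μ ^ 2 * s ^ 2 / 4)))) (Icc 0 r) := by
    refine mono_of (f' := fun s => (μ ^ 2 * s / 2 * cM w x s - cN w x s) *
      Real.exp (-(μ ^ 2 * s ^ 2 / 4))) ?_ ?_
    · intro s hs
      have h1 : HasDerivAt (fun s : ℝ => -(μ ^ 2 * s ^ 2 / 4)) (-(μ ^ 2 * s / 2)) s := by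
        have := ((((hasDerivAt_id s).pow 2).const_mul (μ ^ 2)).div_const 4).neg
        refine HasDerivAt.congr_deriv this ?_
        simp; ring
      refine HasDerivAt.congr_deriv ((cM_deriv hw x s).mul h1.exp).neg ?_
      ring
    · intro s hs
      have := hT h0 (Ioo_subset_Icc_self hs) hs.1.le
      simp only [zero_mul, ne_eq, OfNat.ofNat_ne_zero, not_false_eq_true, zero_pow, mul_zero,
        zero_div, sub_zero] at this
      have h2 : 0 ≤ s * (μ ^ 2 * s / 2 * cM w x s - cN w x s) := by
        refine this.trans_eq ?_; ring
      exact mul_nonneg (nonneg_of_mul_nonneg_right h2 hs.1) (Real.exp_pos _).le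
  have := hE h0 hρ hρ.1
  simp only [cM_zero, hx, mul_zero, zero_mul, neg_zero, Left.nonneg_neg_iff] at this
  exact le_antisymm (nonpos_of_mul_nonpos_left this (Real.exp_pos _)) (cM_nonneg x r hnn ρ hρ)

lemma zero_on (hw : ContDiff ℝ 2 w) (x : E2) (r μ : ℝ)
    (hpan : ∀ y ∈ Metric.closedBall x r, lap w y = μ ^ 2 * w y)
    (hnn : ∀ y ∈ Metric.closedBall x r, 0 ≤ w y) (hx : w x = 0) :
    ∀ y ∈ Metric.closedBall x r, w y = 0 := by
  intro y hy
  obtain ⟨θ, hθ, hz⟩ := exists_polar (y - x)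
  have hρ : ‖y - x‖ ∈ Icc 0 r := ⟨norm_nonneg _, by rwa [mem_closedBall_iff_norm] at hy⟩
  have hM := cM_le hw x r μ hpan hnn hx _ hρ
  have hy' : y = x + ‖y - x‖ • ed θ := by rw [← hz]; abel
  by_contra hne
  have hlt : 0 < w (x + ‖y - x‖ • ed θ) := by
    rw [← hy']; exact lt_of_le_of_ne (hnn y hy) (Ne.symm hne)
  have c1 := ed_cont
  have c2 := hw.continuous
  have := intervalIntegral.integral_lt_integral_of_continuousOn_of_le_of_exists_lt
    (f := fun _ => 0) (g := fun θ => w (x + ‖y - x‖ • ed θ)) (a := -π) (b := π)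
    (by linarith [Real.pi_pos]) continuousOn_const
    (Continuous.continuousOn (by fun_prop))
    (fun t _ => hnn _ (mem_cb x hρ t)) ⟨θ, hθ, hlt⟩
  unfold cM at hM
  rw [hM] at this
  simp at this
end

/-- Global `C²` extension. -/
lemma exists_ext (Ω : Set E2) (hΩo : IsOpen Ω) (v : E2 → ℝ) (hv : ContDiffOn ℝ 2 v Ω)
    (x : E2) (r : ℝ) (hr : 0 < r) (hball : Metric.closedBall x r ⊆ Ω) :
    ∃ w : E2 → ℝ, ContDiff ℝ 2 w ∧ ∀ y ∈ Metric.closedBall x r, w =ᶠ[𝓝 y] v := by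
  obtain ⟨δ, hδ, hsub⟩ := (isCompact_closedBall x r).exists_cthickening_subset_open hΩo hball
  rw [cthickening_closedBall hδ.le hr.le] at hsub
  let b : ContDiffBump x := ⟨r + δ / 2, r + δ, by positivity, by linarith⟩
  refine ⟨fun y => b y * v y, ?_, ?_⟩
  · rw [contDiff_iff_contDiffAt]
    intro y
    by_cases hy : y ∈ Ω
    · exact b.contDiff.contDiffAt.mul (hv.contDiffAt (hΩo.mem_nhds hy))
    · have : (fun y => b y * v y) =ᶠ[𝓝 y] fun _ => 0 := by
        have h : (Metric.closedBall x (r + δ))ᶜ ∈ 𝓝 y :=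
          Metric.isClosed_closedBall.isOpen_compl.mem_nhds fun h =>
            hy (hsub (by rwa [add_comm]))
        filter_upwards [h] with z hz
        have : b z = 0 := b.zero_of_le_dist (by
          simp only [mem_compl_iff, Metric.mem_closedBall, not_le] at hz
          exact hz.le)
        simp [this]
      exact contDiffAt_const.congr_of_eventuallyEq this
  · intro y hy
    have h : Metric.ball x (r + δ / 2) ∈ 𝓝 y :=
      Metric.isOpen_ball.mem_nhds (by
        rw [Metric.mem_closedBall] at hy; rw [Metric.mem_ball]; linarith)
    filter_upwards [h] with z hz
    have : b z = 1 := b.one_of_mem_closedBall (Metric.ball_subset_closedBall hz)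
    simp [this]

lemma lap_congr {w v : E2 → ℝ} {y : E2} (h : w =ᶠ[𝓝 y] v) : lap w y = lap v y := by
  unfold lap
  refine Finset.sum_congr rfl fun i _ => ?_
  have : (fun z => fderiv ℝ w z (EuclideanSpace.single i 1)) =ᶠ[𝓝 y]
      (fun z => fderiv ℝ v z (EuclideanSpace.single i 1)) := by
    filter_upwards [h.fderiv (𝕜 := ℝ)] with z hz
    rw [hz]
  rw [this.fderiv_eq]

/-- Polar coordinates on the plane. -/
lemma integral_polar (f : E2 → ℝ) (x : E2) :
    ∫ y, f y = ∫ p in Ioi (0 : ℝ) ×ˢ Ioo (-π) π, p.1 * f (x + p.1 • ed p.2) := by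
  have h1 : ∫ y, f y = ∫ y, f (x + y) := (integral_add_left_eq_self f x).symm
  rw [h1, ← (PiLp.volume_preserving_toLp (Fin 2)).integral_comp
    (MeasurableEquiv.toLp 2 (Fin 2 → ℝ)).measurableEmbedding,
    ← (volume_preserving_finTwoArrow ℝ).symm.integral_comp
    (MeasurableEquiv.finTwoArrow).symm.measurableEmbedding,
    ← integral_comp_polarCoord_symm]
  simp only [polarCoord_target, smul_eq_mul]
  congr 1
  ext p
  congr 3
  ext i
  fin_cases i <;> simp [ed, polarCoord, MeasurableEquiv.finTwoArrow]

/-- The radial kernel. -/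
noncomputable def kr (r ρ : ℝ) : ℝ := ρ * Real.log r + Real.negMulLog ρ

lemma kr_cont (r : ℝ) : Continuous (kr r) := by
  unfold kr
  have := Real.continuous_negMulLog
  fun_prop

lemma kr_eq {r ρ : ℝ} (hr : 0 < r) (hρ : 0 < ρ) : kr r ρ = ρ * Real.log (r / ρ) := by
  unfold kr
  rw [Real.log_div hr.ne' hρ.ne', Real.negMulLog]
  ring

lemma kr_int {r : ℝ} (hr : 0 < r) : ∫ ρ in (0:ℝ)..r, kr r ρ = r ^ 2 / 4 := by
  have hc : Continuous (fun ρ : ℝ => ρ ^ 2 / 2 * Real.log r + ρ / 2 * Real.negMulLog ρ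
      + ρ ^ 2 / 4) := by
    have := Real.continuous_negMulLog
    fun_prop
  rw [intervalIntegral.integral_eq_sub_of_hasDerivAt_of_le hr.le hc.continuousOn ?_
    ((kr_cont r).intervalIntegrable _ _)]
  · simp [Real.negMulLog]; ring
  · intro ρ hρ
    have h1 := hasDerivAt_id ρ
    have h := ((((h1.pow 2).div_const 2).mul_const (Real.log r)).add
      ((h1.div_const 2).mul (Real.hasDerivAt_negMulLog hρ.1.ne'))).add ((h1.pow 2).div_const 4)
    refine HasDerivAt.congr_deriv h ?_
    simp [kr, Real.negMulLog]
    ring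

lemma integral_ball {w v : E2 → ℝ} (hw : Continuous w) (x : E2) (r : ℝ) (hr : 0 < r)
    (hwv : ∀ y ∈ Metric.closedBall x r, w y = v y) :
    ∫ y in Metric.ball x r, v y * Real.log (r / ‖x - y‖) = ∫ ρ in (0:ℝ)..r, kr r ρ * cM w x ρ := by
  have c1 := ed_cont
  have c2 := kr_cont r
  rw [← MeasureTheory.integral_indicator Metric.isOpen_ball.measurableSet, integral_polar _ x]
  have hG : Continuous (fun p : ℝ × ℝ => kr r p.1 * w (x + p.1 • ed p.2)) := by fun_prop
  have e1 : ∀ p ∈ Ioi (0 : ℝ) ×ˢ Ioo (-π) π,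
      p.1 * (Metric.ball x r).indicator (fun y => v y * Real.log (r / ‖x - y‖)) (x + p.1 • ed p.2)
      = (Ioo (0 : ℝ) r ×ˢ Ioo (-π) π).indicator
        (fun p : ℝ × ℝ => kr r p.1 * w (x + p.1 • ed p.2)) p := by
    rintro ⟨ρ, θ⟩ ⟨h1, h2⟩
    simp only [mem_Ioi] at h1
    by_cases hlt : ρ < r
    · rw [indicator_of_mem, indicator_of_mem]
      · simp only
        rw [kr_eq hr h1, hwv _ (mem_cb x ⟨h1.le, hlt.le⟩ θ)]
        simp [norm_smul, norm_ed, abs_of_pos h1]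
        ring
      · exact ⟨⟨h1, hlt⟩, h2⟩
      · simp [norm_smul, norm_ed, abs_of_pos h1, hlt]
    · rw [indicator_of_notMem, indicator_of_notMem, mul_zero]
      · exact fun h => hlt h.1.2
      · simp [norm_smul, norm_ed, abs_of_pos h1]; linarith
  rw [setIntegral_congr_fun (measurableSet_Ioi.prod measurableSet_Ioo) e1,
    setIntegral_indicator (measurableSet_Ioo.prod measurableSet_Ioo)]
  have e2 : Ioi (0 : ℝ) ×ˢ Ioo (-π) π ∩ Ioo (0 : ℝ) r ×ˢ Ioo (-π) π
      = Ioo (0 : ℝ) r ×ˢ Ioo (-π) π :=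
    inter_eq_right.2 (prod_mono Ioo_subset_Ioi_self subset_rfl)
  rw [e2, Measure.volume_eq_prod, setIntegral_prod, intervalIntegral.integral_of_le hr.le,
    integral_Ioc_eq_integral_Ioo]
  · refine setIntegral_congr_fun measurableSet_Ioo fun ρ _ => ?_
    simp only [cM]
    rw [intervalIntegral.integral_of_le (by linarith [Real.pi_pos]),
      integral_Ioc_eq_integral_Ioo, ← MeasureTheory.integral_const_mul]
  · exact (hG.continuousOn.integrableOn_compact
      ((isCompact_Icc (a := 0) (b := r)).prod (isCompact_Icc (a := -π) (b := π)))).mono_set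
      (prod_mono Ioo_subset_Icc_self Ioo_subset_Icc_self)

theorem weighted_mean_inequality_panharmonic
    (Ω : Set E2) (hΩo : IsOpen Ω) (hΩc : IsConnected Ω)
    (v : E2 → ℝ) (hv : ContDiffOn ℝ 2 v Ω)
    (μ : ℝ) (hμ : 0 < μ)
    (hpan : ∀ y ∈ Ω, lap v y = μ ^ 2 * v y)
    (hnonneg : ∀ y ∈ Ω, 0 ≤ v y)
    (hnontriv : ¬ ∀ y ∈ Ω, v y = 0)
    (x : E2) (r : ℝ) (hr : 0 < r) (hball : Metric.closedBall x r ⊆ Ω) :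
    (1 / 2) * v x <
      (1 / (π * r ^ 2)) * ∫ y in Metric.ball x r, v y * Real.log (r / ‖x - y‖) := by
  have ext : ∀ (x : E2) (r : ℝ), 0 < r → Metric.closedBall x r ⊆ Ω → ∃ w : E2 → ℝ,
      ContDiff ℝ 2 w ∧ (∀ y ∈ Metric.closedBall x r, w y = v y) ∧
      (∀ y ∈ Metric.closedBall x r, lap w y = μ ^ 2 * w y) ∧
      (∀ y ∈ Metric.closedBall x r, 0 ≤ w y) := by
    intro x r hr hb
    obtain ⟨w, hw, h⟩ := exists_ext Ω hΩo v hv x r hr hb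
    refine ⟨w, hw, fun y hy => (h y hy).eq_of_nhds, fun y hy => ?_, fun y hy => ?_⟩
    · rw [lap_congr (h y hy), (h y hy).eq_of_nhds, hpan y (hb hy)]
    · rw [(h y hy).eq_of_nhds]; exact hnonneg y (hb hy)
  have hxΩ : x ∈ Ω := hball (Metric.mem_closedBall_self hr.le)
  have hvx : 0 < v x := by
    by_contra hcon
    have hx0 : v x = 0 := le_antisymm (not_lt.1 hcon) (hnonneg x hxΩ)
    push Not at hnontriv
    obtain ⟨z, hz, hz0⟩ := hnontriv
    have hA : IsOpen (Ω ∩ v ⁻¹' {0}ᶜ) :=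
      hv.continuousOn.isOpen_inter_preimage hΩo isOpen_compl_singleton
    have hB : IsOpen (Ω ∩ v ⁻¹' {0}) := by
      rw [isOpen_iff_mem_nhds]
      rintro y ⟨hy, hy0⟩
      obtain ⟨ε, hε, hsub⟩ := Metric.nhds_basis_closedBall.mem_iff.1 (hΩo.mem_nhds hy)
      obtain ⟨w, hw, h1, h2, h3⟩ := ext y ε hε hsub
      have hz := zero_on hw y ε μ h2 h3 (by
        rw [h1 y (Metric.mem_closedBall_self hε.le)]; exact hy0)
      filter_upwards [Metric.closedBall_mem_nhds y hε] with u hu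
      exact ⟨hsub hu, by rw [mem_preimage, ← h1 u hu, hz u hu]; rfl⟩
    obtain ⟨u, -, ⟨-, hu1⟩, -, hu2⟩ := hΩc.isPreconnected _ _ hA hB
      (fun u hu => by
        by_cases h : v u = 0
        · exact Or.inr ⟨hu, h⟩
        · exact Or.inl ⟨hu, h⟩) ⟨z, hz, hz, hz0⟩ ⟨x, hxΩ, hxΩ, hx0⟩
    exact hu1 hu2
  obtain ⟨w, hw, h1, h2, h3⟩ := ext x r hr hball
  have hwx := h1 x (Metric.mem_closedBall_self hr.le)
  rw [integral_ball hw.continuous x r hr h1]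
  have hM := cM_strict hw x r μ hμ h2 h3 (by rw [hwx]; exact hvx)
  have h0 : (0 : ℝ) ∈ Icc 0 r := ⟨le_rfl, hr.le⟩
  have hcM : Continuous (cM w x) :=
    continuous_iff_continuousAt.2 fun ρ => (cM_deriv hw x ρ).continuousAt
  have hlt : ∫ ρ in (0:ℝ)..r, kr r ρ * cM w x 0 < ∫ ρ in (0:ℝ)..r, kr r ρ * cM w x ρ := by
    have hc := kr_cont r
    refine intervalIntegral.integral_lt_integral_of_continuousOn_of_le_of_exists_lt hr
      (Continuous.continuousOn (by fun_prop)) (Continuous.continuousOn (by fun_prop)) ?_ ?_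
    · intro ρ hρ
      refine mul_le_mul_of_nonneg_left (hM.monotoneOn h0 (Ioc_subset_Icc_self hρ) hρ.1.le) ?_
      rw [kr_eq hr hρ.1]
      exact mul_nonneg hρ.1.le (Real.log_nonneg ((one_le_div hρ.1).2 hρ.2))
    · have hh : r / 2 ∈ Icc 0 r := ⟨by linarith, by linarith⟩
      refine ⟨r / 2, hh, mul_lt_mul_of_pos_left (hM h0 hh (by linarith)) ?_⟩
      rw [kr_eq hr (by linarith)]
      exact mul_pos (by linarith) (Real.log_pos ((one_lt_div (by linarith)).2 (by linarith)))
  rw [intervalIntegral.integral_mul_const, kr_int hr, cM_zero, hwx] at hlt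
  have hp := Real.pi_pos
  calc (1 / 2) * v x = (1 / (π * r ^ 2)) * (r ^ 2 / 4 * (2 * π * v x)) := by
        field_simp; ring
    _ < _ := by gcongr
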